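/- arXiv:1704.02086 — 2 statements merged into one kernel-verified Lean document; each statement's English description precedes it below -/
import Mathlib

section
/- Let F be a prime field of odd order p (so F ≅ ℤ/pℤ with p an odd prime), let H be a subset of F, m ≥ 1, and γ := Σ_{α ∈ H} α. Then for every multilinear polynomial P in F[X₁,…,X_m] (individual degree at most 1): if p does not divide |H|, then Σ_{α ∈ H^m} P(α) = |H|^m · P(γ/|H|, …, γ/|H|); and if p divides |H|, then Σ_{α ∈ H^m} P(α) = 0. -/
open MvPolynomial Finset

/-- Summing a polynomial over a grid `H^σ` factors monomial by monomial into power sums. -/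
theorem MvPolynomial.sum_piFinset_eval {σ R : Type*} [Fintype σ] [DecidableEq σ] [CommSemiring R]
    (H : Finset R) (P : MvPolynomial σ R) :
    ∑ α ∈ Fintype.piFinset (fun _ : σ => H), MvPolynomial.eval α P
      = ∑ d ∈ P.support, P.coeff d * ∏ i, ∑ a ∈ H, a ^ d i := by
  simp_rw [MvPolynomial.eval_eq']
  rw [Finset.sum_comm]
  refine Finset.sum_congr rfl fun d _ => ?_
  rw [← Finset.mul_sum, Finset.prod_univ_sum]

/-- Over `ℤ/pℤ` with `p` odd, the power sums of exponent at most one over a set whose cardinality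
is divisible by `p` vanish. -/
theorem ZMod.sum_pow_eq_zero_of_dvd_card {p : ℕ} [Fact p.Prime] (hodd : Odd p)
    {H : Finset (ZMod p)} (hH : p ∣ H.card) {n : ℕ} (hn : n ≤ 1) :
    ∑ a ∈ H, a ^ n = 0 := by
  rcases H.eq_empty_or_nonempty with rfl | hne
  · simp
  · have h_univ : H = Finset.univ := by
      rw [← Finset.card_eq_iff_eq_univ, ZMod.card]
      exact le_antisymm (by simpa [ZMod.card] using H.card_le_univ)
        (Nat.le_of_dvd hne.card_pos hH)
    rw [h_univ]
    apply FiniteField.sum_pow_lt_card_sub_one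
    have h_two := (Fact.out : p.Prime).two_le
    obtain ⟨k, hk⟩ := hodd
    rw [ZMod.card]
    omega

/-- Corollary A.3 (`cor:prime-field-multilinear`): over the prime field `ℤ/pℤ` with `p` an odd
prime, for every multilinear `m`-variate polynomial `P` and every subset `H`:
if `p ∤ |H|` then `∑_{α ∈ H^m} P(α) = |H|^m · P(γ/|H|, …, γ/|H|)` (with `γ = ∑_{α ∈ H} α`),
and if `p ∣ |H|` then `∑_{α ∈ H^m} P(α) = 0`. -/
theorem prime_field_multilinear_sum
    (p : ℕ) [hp : Fact p.Prime] (hodd : Odd p)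
    (H : Finset (ZMod p)) (m : ℕ) (hm : 1 ≤ m)
    (P : MvPolynomial (Fin m) (ZMod p)) (hP : ∀ i : Fin m, P.degreeOf i ≤ 1) :
    (¬ (p ∣ H.card) →
      ∑ α ∈ Fintype.piFinset (fun _ : Fin m => H), MvPolynomial.eval α P
      = H.card ^ m •
          MvPolynomial.eval (fun _ : Fin m => (∑ a ∈ H, a) * (H.card : ZMod p)⁻¹) P) ∧
    ((p ∣ H.card) →
      ∑ α ∈ Fintype.piFinset (fun _ : Fin m => H), MvPolynomial.eval α P = 0) := by
  have h_exp : ∀ d ∈ P.support, ∀ i, d i ≤ 1 := fun d hd i =>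
    MvPolynomial.degreeOf_le_iff.mp (hP i) d hd
  rw [MvPolynomial.sum_piFinset_eval]
  refine ⟨fun hH => ?_, fun hH => ?_⟩
  · have h_card : (H.card : ZMod p) ≠ 0 := by rwa [Ne, ZMod.natCast_eq_zero_iff]
    rw [MvPolynomial.eval_eq', Finset.smul_sum]
    refine Finset.sum_congr rfl fun d hd => ?_
    have h_pow : ∀ i, ∑ a ∈ H, a ^ d i
        = (H.card : ZMod p) * ((∑ a ∈ H, a) * (H.card : ZMod p)⁻¹) ^ d i := by
      intro i
      rcases Nat.le_one_iff_eq_zero_or_eq_one.mp (h_exp d hd i) with h | h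
      · simp [h]
      · simp only [h, pow_one]
        field_simp
    simp_rw [h_pow]
    rw [Finset.prod_mul_distrib, Finset.prod_const, Finset.card_univ, Fintype.card_fin,
      nsmul_eq_mul, Nat.cast_pow]
    ring
  · refine Finset.sum_eq_zero fun d hd => ?_
    rw [Finset.prod_eq_zero (Finset.mem_univ (⟨0, hm⟩ : Fin m))
      (ZMod.sum_pow_eq_zero_of_dvd_card hodd hH (h_exp d hd _)), mul_zero]
end

section
/- Let F be a finite field, G a nonempty subset of F, m, k ≥ 1, and d, d' natural numbers with d' ≥ 2(|G| − 1). Let Z be a uniformly random element of the finite space 𝒫 of polynomials Z(X₁,…,X_m,Y₁,…,Y_k) over F of individual degree at most d in each X-variable and at most d' in each Y-variable, and define the random m-variate polynomial R by R(X₁,…,X_m) := Σ_{y ∈ G^k} Z(X₁,…,X_m, y), which has individual degree at most d. Then: (i) R is uniformly distributed over the space of all m-variate polynomials over F of individual degree at most d; and (ii) for every subset Q ⊆ F^{m+k} with |Q| < |G|^k and every assignment of values (w_q)_{q ∈ Q} ∈ F^Q that occurs with positive probability, the conditional distribution of R given that Z(q) = w_q for all q ∈ Q is still the uniform distribution over the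 space of m-variate polynomials of individual degree at most d. -/
open MvPolynomial Finset

/-- The space of polynomials `Z(X₁,…,X_m,Y₁,…,Y_k)` of individual degree at most `d` in each
`X`-variable and at most `d'` in each `Y`-variable. -/
def SpaceZ (F : Type*) [Field F] (m k d d' : ℕ) : Set (MvPolynomial (Fin m ⊕ Fin k) F) :=
  {Z | (∀ i : Fin m, Z.degreeOf (Sum.inl i) ≤ d) ∧ (∀ j : Fin k, Z.degreeOf (Sum.inr j) ≤ d')}

/-- The space of `m`-variate polynomials of individual degree at most `d`. -/
def SpaceW (F : Type*) [Field F] (m d : ℕ) : Set (MvPolynomial (Fin m) F) :=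
  {W | ∀ i : Fin m, W.degreeOf i ≤ d}

/-- The `m`-variate polynomial `R(X) = ∑_{y ∈ G^k} Z(X, y)`, obtained by substituting each
`y ∈ G^k` for the `Y`-variables of `Z` and summing. -/
noncomputable def SumOutY (F : Type*) [Field F] (m k : ℕ) (G : Finset F)
    (Z : MvPolynomial (Fin m ⊕ Fin k) F) : MvPolynomial (Fin m) F :=
  ∑ y ∈ Fintype.piFinset (fun _ : Fin k => G),
    MvPolynomial.aeval
      (Sum.elim (fun i : Fin m => (MvPolynomial.X i : MvPolynomial (Fin m) F))
                (fun j : Fin k => MvPolynomial.C (y j))) Z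

section Counting

variable {V U : Type*} [AddCommGroup V] [AddCommGroup U]

/-- If `K` translates `A` into itself and `f` maps `K` onto `T`, then all fibres of `f : A → T`
have the same cardinality. -/
theorem card_fiber_mul_card {A K : Set V} {T : Set U} (f : V →+ U)
    (hf : ∀ z ∈ A, f z ∈ T) (hT : ∀ s ∈ T, ∀ t ∈ T, s - t ∈ T)
    (hadd : ∀ z ∈ A, ∀ u ∈ K, z + u ∈ A) (hsub : ∀ z ∈ A, ∀ u ∈ K, z - u ∈ A)
    (hsurj : ∀ t ∈ T, ∃ u ∈ K, f u = t) {t : U} (ht : t ∈ T) :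
    Nat.card {z // z ∈ A ∧ f z = t} * Nat.card {t // t ∈ T} = Nat.card {z // z ∈ A} := by
  choose s hsK hs using hsurj
  rw [← Nat.card_prod]
  refine Nat.card_congr
    { toFun := fun p => ⟨p.1.1 + s (p.2.1 - t) (hT _ p.2.2 _ ht), hadd _ p.1.2.1 _ (hsK _ _)⟩
      invFun := fun z => ⟨⟨z.1 - s (f z.1 - t) (hT _ (hf _ z.2) _ ht),
        hsub _ z.2 _ (hsK _ _), by rw [map_sub, hs]; abel⟩, ⟨f z.1, hf _ z.2⟩⟩
      left_inv := ?_
      right_inv := ?_ }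
  · rintro ⟨⟨z, hz, hzt⟩, ⟨t', ht'⟩⟩
    have h : f (z + s (t' - t) (hT _ ht' _ ht)) = t' := by rw [map_add, hs, hzt]; abel
    simp [h]
  · rintro ⟨z, hz⟩
    simp

theorem card_fiber_div_card {A K : Set V} {T : Set U} (f : V →+ U)
    (hf : ∀ z ∈ A, f z ∈ T) (hT : ∀ s ∈ T, ∀ t ∈ T, s - t ∈ T)
    (hadd : ∀ z ∈ A, ∀ u ∈ K, z + u ∈ A) (hsub : ∀ z ∈ A, ∀ u ∈ K, z - u ∈ A)
    (hsurj : ∀ t ∈ T, ∃ u ∈ K, f u = t) (hA : 0 < Nat.card {z // z ∈ A}) {t : U} (ht : t ∈ T) :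
    (Nat.card {z // z ∈ A ∧ f z = t} : ℚ) / (Nat.card {z // z ∈ A} : ℚ)
      = 1 / (Nat.card {t // t ∈ T} : ℚ) := by
  have h := card_fiber_mul_card f hf hT hadd hsub hsurj ht
  have hT0 : Nat.card {t // t ∈ T} ≠ 0 := fun h0 => by rw [h0, mul_zero] at h; omega
  rw [div_eq_div_iff (by exact_mod_cast hA.ne') (by exact_mod_cast hT0), one_mul]
  exact_mod_cast h

end Counting

section Degree

variable {σ R : Type*} [CommRing R]

theorem finite_setOf_degreeOf_le [Finite σ] [Finite R] (N : ℕ) :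
    {p : MvPolynomial σ R | ∀ i, p.degreeOf i ≤ N}.Finite := by
  let s : Set (σ →₀ ℕ) := {n | ∀ i, n i ≤ N}
  have hs : s.Finite := by
    have h : {n : σ → ℕ | ∀ i, n i ≤ N}.Finite := Set.Finite.pi' fun _ => Set.finite_Iic N
    exact h.preimage DFunLike.coe_injective.injOn
  have := hs.to_subtype
  have : Module.Finite R (restrictSupport R s) := .of_basis (basisRestrictSupport R s)
  have : Finite (restrictSupport R s) := Module.finite_of_finite R
  refine (Set.toFinite (restrictSupport R s : Set (MvPolynomial σ R))).subset fun p hp => ?_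
  rw [SetLike.mem_coe, mem_restrictSupport_iff]
  exact fun n hn i => degreeOf_le_iff.mp (hp i) n hn

theorem degreeOf_rename_of_notMem_range {τ : Type*} {f : σ → τ} {i : τ} (hi : i ∉ Set.range f)
    (p : MvPolynomial σ R) : (rename f p).degreeOf i = 0 := by
  classical
  by_contra h
  obtain ⟨j, -, rfl⟩ := Finset.mem_image.mp (vars_rename f p (mem_vars_iff_degreeOf_ne_zero.mpr h))
  exact hi ⟨j, rfl⟩

theorem degreeOf_aeval_sumElim_X_C_le {τ : Type*} [Fintype σ] [Fintype τ] [Nontrivial R]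
    (y : τ → R) (p : MvPolynomial (σ ⊕ τ) R) (i : σ) :
    (aeval (Sum.elim (X : σ → MvPolynomial σ R) fun j => C (y j)) p).degreeOf i
      ≤ p.degreeOf (Sum.inl i) := by
  classical
  rw [aeval_def, eval₂_eq']
  refine (degreeOf_sum_le _ _ _).trans (Finset.sup_le fun n hn => ?_)
  refine le_trans ?_ (monomial_le_degreeOf (Sum.inl i) hn)
  rw [Fintype.prod_sum_type, algebraMap_eq]
  simp only [Sum.elim_inl, Sum.elim_inr, ← C_pow, ← map_prod]
  refine (degreeOf_C_mul_le _ _ _).trans ((degreeOf_mul_C_le _ _ _).trans ?_)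
  refine (degreeOf_prod_le _ _ _).trans ?_
  calc ∑ j, degreeOf i ((X j : MvPolynomial σ R) ^ n (Sum.inl j))
      ≤ ∑ j, if i = j then n (Sum.inl i) else 0 := Finset.sum_le_sum fun j _ => by
        split_ifs with h
        · subst h; simp
        · rw [degreeOf_X_pow_of_ne _ h]
    _ = n (Sum.inl i) := by simp

end Degree

section Mask

variable {F : Type*} [Field F] {m k d d' : ℕ}

theorem SpaceZ.add_mem {p q : MvPolynomial (Fin m ⊕ Fin k) F} (hp : p ∈ SpaceZ F m k d d')
    (hq : q ∈ SpaceZ F m k d d') : p + q ∈ SpaceZ F m k d d' :=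
  ⟨fun i => (degreeOf_add_le _ _ _).trans (max_le (hp.1 i) (hq.1 i)),
    fun j => (degreeOf_add_le _ _ _).trans (max_le (hp.2 j) (hq.2 j))⟩

theorem SpaceZ.sub_mem {p q : MvPolynomial (Fin m ⊕ Fin k) F} (hp : p ∈ SpaceZ F m k d d')
    (hq : q ∈ SpaceZ F m k d d') : p - q ∈ SpaceZ F m k d d' :=
  ⟨fun i => (degreeOf_sub_le _ _ _).trans (max_le (hp.1 i) (hq.1 i)),
    fun j => (degreeOf_sub_le _ _ _).trans (max_le (hp.2 j) (hq.2 j))⟩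

theorem SpaceW.sub_mem {p q : MvPolynomial (Fin m) F} (hp : p ∈ SpaceW F m d)
    (hq : q ∈ SpaceW F m d) : p - q ∈ SpaceW F m d :=
  fun i => (degreeOf_sub_le _ _ _).trans (max_le (hp i) (hq i))

theorem SpaceZ.finite [Finite F] : (SpaceZ F m k d d').Finite := by
  refine (finite_setOf_degreeOf_le (max d d')).subset fun p hp => ?_
  rintro (i | j)
  · exact (hp.1 i).trans (le_max_left _ _)
  · exact (hp.2 j).trans (le_max_right _ _)

theorem degreeOf_SumOutY_le (G : Finset F) {Z : MvPolynomial (Fin m ⊕ Fin k) F}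
    (hZ : Z ∈ SpaceZ F m k d d') (i : Fin m) : (SumOutY F m k G Z).degreeOf i ≤ d :=
  (degreeOf_sum_le _ _ _).trans
    (Finset.sup_le fun y _ => (degreeOf_aeval_sumElim_X_C_le y Z i).trans (hZ.1 i))

theorem SumOutY_add (G : Finset F) (p q : MvPolynomial (Fin m ⊕ Fin k) F) :
    SumOutY F m k G (p + q) = SumOutY F m k G p + SumOutY F m k G q := by
  simp only [SumOutY, map_add, Finset.sum_add_distrib]

theorem SumOutY_rename_mul_rename (G : Finset F) (W : MvPolynomial (Fin m) F)
    (P : MvPolynomial (Fin k) F) :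
    SumOutY F m k G (rename Sum.inl W * rename Sum.inr P)
      = W * C (∑ y ∈ Fintype.piFinset fun _ : Fin k => G, eval y P) := by
  rw [SumOutY, map_sum, Finset.mul_sum]
  refine Finset.sum_congr rfl fun y _ => ?_
  have h : aeval (fun j => (C (y j) : MvPolynomial (Fin m) F)) P = C (eval y P) :=
    aeval_algebraMap_apply (MvPolynomial (Fin m) F) y P
  rw [map_mul, aeval_rename, aeval_rename, Sum.elim_comp_inl, Sum.elim_comp_inr, h]
  congr 1
  exact aeval_X_left_apply W

/-- The product `∏ⱼ ∏_{g ∈ G, g ≠ yⱼ} (Yⱼ - g)`, which on the grid `Gᵏ` is supported at `y`. -/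
noncomputable def gridBasis [DecidableEq F] (G : Finset F) (y : Fin k → F) :
    MvPolynomial (Fin k) F :=
  ∏ j, ∏ g ∈ G.erase (y j), (X j - C g)

theorem degreeOf_gridBasis_le [DecidableEq F] (G : Finset F) {y : Fin k → F}
    (hy : y ∈ Fintype.piFinset fun _ : Fin k => G) (i : Fin k) :
    (gridBasis G y).degreeOf i ≤ G.card - 1 := by
  refine (degreeOf_prod_le _ _ _).trans ?_
  calc ∑ j, degreeOf i (∏ g ∈ G.erase (y j), (X j - C g))
      ≤ ∑ j, if i = j then G.card - 1 else 0 := Finset.sum_le_sum fun j _ => by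
        refine (degreeOf_prod_le _ _ _).trans ?_
        rw [← Finset.card_erase_of_mem (Fintype.mem_piFinset.mp hy j)]
        have h (g : F) : degreeOf i (X j - C g) ≤ if i = j then 1 else 0 :=
          (degreeOf_sub_le _ _ _).trans (by rw [degreeOf_X, degreeOf_C, max_eq_left (zero_le)])
        refine (Finset.sum_le_sum fun g _ => h g).trans ?_
        split_ifs <;> simp
    _ = G.card - 1 := by simp

theorem eval_gridBasis_self_ne_zero [DecidableEq F] (G : Finset F) (y : Fin k → F) :
    eval y (gridBasis G y) ≠ 0 := by
  simp only [gridBasis, map_prod, map_sub, eval_X, eval_C]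
  exact Finset.prod_ne_zero_iff.mpr fun j _ => Finset.prod_ne_zero_iff.mpr fun g hg =>
    sub_ne_zero.mpr (Finset.ne_of_mem_erase hg).symm

theorem eval_gridBasis_of_ne [DecidableEq F] (G : Finset F) {y z : Fin k → F}
    (hz : z ∈ Fintype.piFinset fun _ : Fin k => G) (h : z ≠ y) :
    eval z (gridBasis G y) = 0 := by
  obtain ⟨j, hj⟩ := Function.ne_iff.mp h
  simp only [gridBasis, map_prod, map_sub, eval_X, eval_C]
  exact Finset.prod_eq_zero (Finset.mem_univ j) (Finset.prod_eq_zero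
    (Finset.mem_erase.mpr ⟨hj, Fintype.mem_piFinset.mp hz j⟩) (sub_self _))

/-- Fewer than `|G|ᵏ` points can be avoided by a polynomial of individual degree at most
`2(|G| - 1)` whose sum over the grid `Gᵏ` is nonzero. -/
theorem exists_eval_eq_zero_and_sum_ne_zero (G : Finset F) {ι : Type*} (Q : Finset ι)
    (v : ι → Fin k → F) (hQ : Q.card < G.card ^ k) :
    ∃ P : MvPolynomial (Fin k) F, (∀ j, P.degreeOf j ≤ 2 * (G.card - 1)) ∧
      (∀ q ∈ Q, eval (v q) P = 0) ∧
      ∑ y ∈ Fintype.piFinset fun _ : Fin k => G, eval y P ≠ 0 := by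
  classical
  set S := Fintype.piFinset fun _ : Fin k => G with hS
  let φ : (S → F) →ₗ[F] (Q → F) :=
    LinearMap.pi fun q => ∑ y : S, eval (v q) (gridBasis G y.1) • LinearMap.proj y
  have hφ : LinearMap.ker φ ≠ ⊥ := φ.ker_ne_bot_of_finrank_lt (by simpa [hS] using hQ)
  obtain ⟨c, hc, hc0⟩ := Submodule.exists_mem_ne_zero_of_ne_bot hφ
  obtain ⟨y, hy⟩ := Function.ne_iff.mp hc0
  let A : MvPolynomial (Fin k) F := ∑ z : S, C (c z) * gridBasis G z.1
  have hA : eval y.1 A = c y * eval y.1 (gridBasis G y.1) := by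
    simp only [A, map_sum, map_mul, eval_C]
    refine Finset.sum_eq_single y (fun z _ hz => ?_) (by simp)
    rw [eval_gridBasis_of_ne G y.2 fun h => hz (Subtype.ext h.symm), mul_zero]
  refine ⟨A * gridBasis G y.1, fun j => ?_, fun q hq => ?_, ?_⟩
  · rw [two_mul]
    refine (degreeOf_mul_le _ _ _).trans (add_le_add ?_ (degreeOf_gridBasis_le G y.2 j))
    exact (degreeOf_sum_le _ _ _).trans (Finset.sup_le fun z _ =>
      (degreeOf_C_mul_le _ _ _).trans (degreeOf_gridBasis_le G z.2 j))
  · have h := congrFun (LinearMap.mem_ker.mp hc) ⟨q, hq⟩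
    have : eval (v q) A = 0 := by
      simpa [φ, A, mul_comm] using h
    rw [map_mul, this, zero_mul]
  · rw [Finset.sum_eq_single_of_mem y.1 y.2 fun z hz h => by
      rw [map_mul, eval_gridBasis_of_ne G hz h, mul_zero], map_mul, hA]
    exact mul_ne_zero (mul_ne_zero hy (eval_gridBasis_self_ne_zero G _))
      (eval_gridBasis_self_ne_zero G _)

theorem exists_mem_SpaceZ_SumOutY_eq (G : Finset F) (hd' : 2 * (G.card - 1) ≤ d')
    {Q : Finset ((Fin m → F) × (Fin k → F))} (hQ : Q.card < G.card ^ k)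
    {W : MvPolynomial (Fin m) F} (hW : W ∈ SpaceW F m d) :
    ∃ Z ∈ SpaceZ F m k d d',
      (∀ q ∈ Q, eval (Sum.elim q.1 q.2) Z = 0) ∧ SumOutY F m k G Z = W := by
  obtain ⟨P, hdeg, hP, hsum⟩ := exists_eval_eq_zero_and_sum_ne_zero G Q Prod.snd hQ
  set a := ∑ y ∈ Fintype.piFinset fun _ : Fin k => G, eval y P with ha
  refine ⟨rename Sum.inl (C a⁻¹ * W) * rename Sum.inr P, ⟨fun i => ?_, fun j => ?_⟩,
    fun q hq => ?_, ?_⟩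
  · refine (degreeOf_mul_le _ _ _).trans ?_
    rw [degreeOf_rename_of_injective Sum.inl_injective,
      degreeOf_rename_of_notMem_range (by simp), add_zero]
    exact (degreeOf_C_mul_le _ _ _).trans (hW i)
  · refine (degreeOf_mul_le _ _ _).trans ?_
    rw [degreeOf_rename_of_injective Sum.inr_injective,
      degreeOf_rename_of_notMem_range (by simp), zero_add]
    exact (hdeg j).trans hd'
  · rw [map_mul, eval_rename, eval_rename, Sum.elim_comp_inr, hP q hq, mul_zero]
  · rw [SumOutY_rename_mul_rename, ← ha, mul_right_comm, ← C_mul, inv_mul_cancel₀ hsum, C_1,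
      one_mul]

theorem card_SumOutY_fiber_div_card (G : Finset F) (hd' : 2 * (G.card - 1) ≤ d')
    {Q : Finset ((Fin m → F) × (Fin k → F))} (hQ : Q.card < G.card ^ k)
    (w : (Fin m → F) × (Fin k → F) → F)
    (hpos : 0 < Nat.card {Z : MvPolynomial (Fin m ⊕ Fin k) F //
      Z ∈ SpaceZ F m k d d' ∧ ∀ q ∈ Q, eval (Sum.elim q.1 q.2) Z = w q})
    {W : MvPolynomial (Fin m) F} (hW : W ∈ SpaceW F m d) :
    (Nat.card {Z : MvPolynomial (Fin m ⊕ Fin k) F //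
        (Z ∈ SpaceZ F m k d d' ∧ ∀ q ∈ Q, eval (Sum.elim q.1 q.2) Z = w q) ∧
          SumOutY F m k G Z = W} : ℚ)
      / (Nat.card {Z : MvPolynomial (Fin m ⊕ Fin k) F //
        Z ∈ SpaceZ F m k d d' ∧ ∀ q ∈ Q, eval (Sum.elim q.1 q.2) Z = w q} : ℚ)
      = 1 / (Nat.card {W' : MvPolynomial (Fin m) F // W' ∈ SpaceW F m d} : ℚ) := by
  refine card_fiber_div_card
    (A := {Z | Z ∈ SpaceZ F m k d d' ∧ ∀ q ∈ Q, eval (Sum.elim q.1 q.2) Z = w q})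
    (K := {Z | Z ∈ SpaceZ F m k d d' ∧ ∀ q ∈ Q, eval (Sum.elim q.1 q.2) Z = 0})
    (T := SpaceW F m d) (AddMonoidHom.mk' (SumOutY F m k G) (SumOutY_add G))
    (fun Z hZ => degreeOf_SumOutY_le G hZ.1) (fun _ hs _ ht => SpaceW.sub_mem hs ht)
    (fun Z hZ u hu => ⟨SpaceZ.add_mem hZ.1 hu.1, fun q hq => ?_⟩)
    (fun Z hZ u hu => ⟨SpaceZ.sub_mem hZ.1 hu.1, fun q hq => ?_⟩)
    (fun W' hW' => ?_) hpos hW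
  · rw [map_add, hZ.2 q hq, hu.2 q hq, add_zero]
  · rw [map_sub, hZ.2 q hq, hu.2 q hq, sub_zero]
  · obtain ⟨Z, hZ, hZQ, hZW⟩ := exists_mem_SpaceZ_SumOutY_eq G hd' hQ hW'
    exact ⟨Z, ⟨hZ, hZQ⟩, hZW⟩

end Mask


/-- The algebraic commitment hiding property (Sections 2.2 and 5): for a uniformly random
polynomial `Z` of individual degree `≤ d` in the `X`-variables and `≤ d' ≥ 2(|G|−1)` in the
`Y`-variables, the polynomial `R(X) := ∑_{y ∈ G^k} Z(X, y)`:
(i) has individual degree at most `d`;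
(ii) is uniformly distributed over the `m`-variate polynomials of individual degree `≤ d`; and
(iii) remains uniformly distributed even conditioned on any (positive-probability) assignment
of values to fewer than `|G|^k` evaluations of `Z`.
Probabilities are counting ratios for the uniform measure on the finite polynomial spaces. -/
theorem commitment_mask_uniform
    (F : Type*) [Field F] [Fintype F]
    (G : Finset F) (hG : G.Nonempty) (m k : ℕ) (hm : 1 ≤ m) (hk : 1 ≤ k)
    (d d' : ℕ) (hd' : 2 * (G.card - 1) ≤ d') :
    (∀ Z ∈ SpaceZ F m k d d', ∀ i : Fin m, (SumOutY F m k G Z).degreeOf i ≤ d) ∧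
    (∀ W ∈ SpaceW F m d,
      (Nat.card {Z : MvPolynomial (Fin m ⊕ Fin k) F //
          Z ∈ SpaceZ F m k d d' ∧ SumOutY F m k G Z = W} : ℚ)
        / (Nat.card {Z : MvPolynomial (Fin m ⊕ Fin k) F // Z ∈ SpaceZ F m k d d'} : ℚ)
      = 1 / (Nat.card {W' : MvPolynomial (Fin m) F // W' ∈ SpaceW F m d} : ℚ)) ∧
    (∀ Q : Finset ((Fin m → F) × (Fin k → F)), Q.card < G.card ^ k →
      ∀ w : (Fin m → F) × (Fin k → F) → F,
        0 < Nat.card {Z : MvPolynomial (Fin m ⊕ Fin k) F //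
              Z ∈ SpaceZ F m k d d' ∧
              ∀ q ∈ Q, MvPolynomial.eval (Sum.elim q.1 q.2) Z = w q} →
        ∀ W ∈ SpaceW F m d,
          (Nat.card {Z : MvPolynomial (Fin m ⊕ Fin k) F //
              Z ∈ SpaceZ F m k d d' ∧
              (∀ q ∈ Q, MvPolynomial.eval (Sum.elim q.1 q.2) Z = w q) ∧
              SumOutY F m k G Z = W} : ℚ)
            / (Nat.card {Z : MvPolynomial (Fin m ⊕ Fin k) F //
                Z ∈ SpaceZ F m k d d' ∧
                ∀ q ∈ Q, MvPolynomial.eval (Sum.elim q.1 q.2) Z = w q} : ℚ)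
          = 1 / (Nat.card {W' : MvPolynomial (Fin m) F // W' ∈ SpaceW F m d} : ℚ)) := by
  refine ⟨fun Z hZ => degreeOf_SumOutY_le G hZ, fun W hW => ?_, fun Q hQ w hpos W hW => ?_⟩
  · have : Finite {Z // Z ∈ SpaceZ F m k d d'} := SpaceZ.finite.to_subtype
    have : Nonempty {Z // Z ∈ SpaceZ F m k d d'} := ⟨⟨0, by simp [SpaceZ]⟩⟩
    have hpos : 0 < Nat.card {Z // Z ∈ SpaceZ F m k d d'} := Nat.card_pos
    simpa using card_SumOutY_fiber_div_card (Q := ∅) G hd' (by simp [hG.card_pos]) 0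
      (by simpa using hpos) hW
  · simpa only [and_assoc] using card_SumOutY_fiber_div_card G hd' hQ w hpos hW
end
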